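/- arXiv:2109.00801 — 2 statements merged into one kernel-verified Lean document; each statement's English description precedes it below -/
import Mathlib

section
/- Let A be a commutative ring, f ∈ A, and c ≥ 0 an integer such that A[f^∞] = A[f^c]. Put A' = A/A[f^c], which is an f-torsion-free ring. Let N be an A-module which is f-adically complete and such that N/f^nN is a flat A/f^nA-module for every n ≥ 1. Then the A'-module N' = N ⊗_A A' is f-torsion-free (multiplication by f on N' is injective) and f-adically complete. -/
open TensorProduct

universe u

theorem Submodule.mem_span_singleton_pow_smul_top {A M : Type*} [CommRing A] [AddCommGroup M]
    [Module A M] {f : A} {n : ℕ} {x : M} :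
    x ∈ (Ideal.span {f} ^ n • ⊤ : Submodule A M) ↔ ∃ y : M, f ^ n • y = x := by
  rw [Ideal.span_singleton_pow, Submodule.ideal_span_singleton_smul,
    Submodule.mem_smul_pointwise_iff_exists]
  simp

theorem IsHausdorff.eq_zero_of_forall_exists_pow_smul {A M : Type*} [CommRing A] [AddCommGroup M]
    [Module A M] {f : A} (h : IsHausdorff (Ideal.span {f}) M) {x : M}
    (hx : ∀ n : ℕ, ∃ y : M, f ^ n • y = x) : x = 0 :=
  h.haus x fun n => SModEq.zero.mpr (Submodule.mem_span_singleton_pow_smul_top.mpr (hx n))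

theorem IsPrecomplete.of_surjective {A M N : Type*} [CommRing A] [AddCommGroup M] [Module A M]
    [AddCommGroup N] [Module A N] {I : Ideal A} [IsPrecomplete I M] (g : M →ₗ[A] N)
    (hg : Function.Surjective g) : IsPrecomplete I N := by
  rw [← AdicCompletion.of_surjective_iff]
  intro y
  obtain ⟨z, rfl⟩ := AdicCompletion.map_surjective I hg y
  obtain ⟨x, rfl⟩ := AdicCompletion.of_surjective I M z
  exact ⟨g x, (AdicCompletion.map_of I g x).symm⟩

theorem TensorProduct.one_tmul_eq_zero_iff_mem_smul_top {A M : Type*} [CommRing A]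
    [AddCommGroup M] [Module A M] (I : Ideal A) (x : M) :
    (1 : A ⧸ I) ⊗ₜ[A] x = 0 ↔ x ∈ (I • ⊤ : Submodule A M) := by
  rw [← (quotTensorEquivQuotSMul M I).map_eq_zero_iff, quotTensorEquivQuotSMul_mk_one_tmul,
    Submodule.Quotient.mk_eq_zero]

theorem TensorProduct.mk_quotient_one_surjective {A M : Type*} [CommRing A]
    [AddCommGroup M] [Module A M] (I : Ideal A) :
    Function.Surjective (TensorProduct.mk A (A ⧸ I) M 1) :=
  TensorProduct.mk_surjective A M _ Ideal.Quotient.mk_surjective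

/-- If `M/IM` is flat over `A/I`, then elements of `M` killed by `a` modulo `I` are combinations,
modulo `I`, of elements of `A` killed by `a` modulo `I`. -/
theorem Module.Flat.mem_colon_smul_top_sup {A M : Type*} [CommRing A] [AddCommGroup M]
    [Module A M] (I : Ideal A) [Module.Flat (A ⧸ I) ((A ⧸ I) ⊗[A] M)] {a : A} {x : M}
    (hx : a • x ∈ (I • ⊤ : Submodule A M)) :
    ∃ z ∈ ((Submodule.comap (LinearMap.mulLeft A a) I : Ideal A) • ⊤ : Submodule A M),
      x - z ∈ (I • ⊤ : Submodule A M) := by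
  have h : ∑ _i : Unit, Ideal.Quotient.mk I a • ((1 : A ⧸ I) ⊗ₜ[A] x) = 0 := by
    rw [← TensorProduct.one_tmul_eq_zero_iff_mem_smul_top, TensorProduct.tmul_smul] at hx
    simpa [← Ideal.Quotient.algebraMap_eq, algebraMap_smul] using hx
  obtain ⟨k, b, y, hxy, hb⟩ := Module.Flat.isTrivialRelation_of_sum_smul_eq_zero h
  choose b' hb' using fun j => Ideal.Quotient.mk_surjective (b () j)
  choose y' hy' using fun j => TensorProduct.mk_quotient_one_surjective I (y j)
  refine ⟨∑ j, b' j • y' j, Submodule.sum_mem _ fun j _ =>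
    Submodule.smul_mem_smul ?_ Submodule.mem_top, ?_⟩
  · have := hb j
    simp only [Finset.univ_unique, Finset.sum_singleton] at this
    rw [PUnit.default_eq_unit, ← hb', ← map_mul, Ideal.Quotient.eq_zero_iff_mem] at this
    simpa using this
  · rw [← TensorProduct.one_tmul_eq_zero_iff_mem_smul_top, TensorProduct.tmul_sub,
      sub_eq_zero, TensorProduct.tmul_sum]
    refine (hxy ()).trans ?_
    refine Finset.sum_congr rfl fun j _ => ?_
    rw [TensorProduct.tmul_smul, ← hb', ← hy', ← Ideal.Quotient.algebraMap_eq, algebraMap_smul]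
    rfl

/-- Let `A[f^∞] = A[f^c]` and put `A' = A/A[f^c]`, which is an
`f`-torsion-free ring. If `N` is an `f`-adically complete `A`-module with `N/f^nN` flat over
`A/f^nA` for all `n ≥ 1`, then `N' = N ⊗_A A'` is `f`-torsion-free and `f`-adically
complete. (Here we realize `N ⊗_A A'` as `A' ⊗[A] N`.) -/
theorem torsionFree_complete_of_quotient_base_change (A : Type u) [CommRing A] (f : A) (c : ℕ)
    (hbdd : ∀ x : A, (∃ n : ℕ, f ^ n * x = 0) → f ^ c * x = 0)
    (N : Type u) [AddCommGroup N] [Module A N]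
    (hcomplete : IsAdicComplete (Ideal.span {f}) N)
    (hflat : ∀ n : ℕ, 1 ≤ n →
      Module.Flat (A ⧸ (Ideal.span {f} ^ n)) ((A ⧸ (Ideal.span {f} ^ n)) ⊗[A] N)) :
    -- `A' = A/A[f^c]` is `f`-torsion-free
    (Function.Injective
      (fun y : A ⧸ (Submodule.torsionBy A A (f ^ c) : Ideal A) => f • y)) ∧
    -- `N' = A' ⊗_A N` is `f`-torsion-free
    (Function.Injective
      (fun x : (A ⧸ (Submodule.torsionBy A A (f ^ c) : Ideal A)) ⊗[A] N => f • x)) ∧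
    -- `N'` is `f`-adically complete
    IsAdicComplete (Ideal.span {f})
      ((A ⧸ (Submodule.torsionBy A A (f ^ c) : Ideal A)) ⊗[A] N) := by
  set T : Ideal A := Submodule.torsionBy A A (f ^ c) with hT
  have memT {a : A} (n : ℕ) (h : f ^ n * a = 0) : a ∈ T := by
    rw [hT, Submodule.mem_torsionBy_iff]
    exact hbdd a ⟨n, h⟩
  have hausN := hcomplete.toIsHausdorff
  have precN := hcomplete.toIsPrecomplete
  have approx (m k : ℕ) (x : N) (hx : f ^ m • x = 0) :
      ∃ t ∈ (T • ⊤ : Submodule A N), ∃ y : N, x = t + f ^ k • y := by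
    have := hflat (m + (k + 1)) (by omega)
    obtain ⟨z, hz, hxz⟩ := Module.Flat.mem_colon_smul_top_sup (Ideal.span {f} ^ (m + (k + 1)))
      (a := f ^ m) (x := x) (by rw [hx]; exact zero_mem _)
    obtain ⟨w, hw⟩ := Submodule.mem_span_singleton_pow_smul_top.mp hxz
    have hcolon : Submodule.comap (LinearMap.mulLeft A (f ^ m))
          (Ideal.span {f} ^ (m + (k + 1))) ≤
        T ⊔ Ideal.span {f} ^ k := by
      intro a ha
      rw [Submodule.mem_comap, LinearMap.mulLeft_apply, Ideal.span_singleton_pow,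
        Ideal.mem_span_singleton] at ha
      obtain ⟨b, hb⟩ := ha
      rw [Submodule.mem_sup]
      refine ⟨a - f ^ (k + 1) * b, memT m ?_, f ^ (k + 1) * b, ?_, by ring⟩
      · rw [mul_sub, hb]; ring
      · rw [Ideal.span_singleton_pow, Ideal.mem_span_singleton]
        exact ⟨f * b, by ring⟩
    have hz' := Submodule.smul_mono_left (N := (⊤ : Submodule A N)) hcolon hz
    rw [Submodule.sup_smul, Submodule.mem_sup] at hz'
    obtain ⟨t, ht, s, hs, rfl⟩ := hz'
    obtain ⟨v, rfl⟩ := Submodule.mem_span_singleton_pow_smul_top.mp hs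
    refine ⟨t, ht, v + f ^ (m + 1) • w, ?_⟩
    rw [eq_add_of_sub_eq hw.symm, smul_add, smul_smul]
    ring_nf
    abel
  have killed {z : N} (hz : z ∈ (T • ⊤ : Submodule A N)) : f ^ c • z = 0 := by
    refine Submodule.smul_induction_on hz (fun t ht n _ => ?_) fun x y hx hy => by
      rw [smul_add, hx, hy, add_zero]
    rw [hT, Submodule.mem_torsionBy_iff] at ht
    rw [← smul_assoc, ht, zero_smul]
  have inter {z y : N} (hz : z ∈ (T • ⊤ : Submodule A N)) (hy : f ^ c • y = z) : z = 0 := by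
    refine hausN.eq_zero_of_forall_exists_pow_smul fun k => ?_
    obtain ⟨t, ht, v, rfl⟩ := approx (c + c) k y (by rw [pow_add, mul_smul, hy, killed hz])
    refine ⟨f ^ c • v, ?_⟩
    rw [← hy, smul_add, killed ht, zero_add, smul_comm]
  have closed {x : N} (hx : ∀ k : ℕ, ∃ t ∈ (T • ⊤ : Submodule A N), ∃ y : N, x = t + f ^ k • y) :
      x ∈ (T • ⊤ : Submodule A N) := by
    obtain ⟨t, ht, y, hty⟩ := hx c
    suffices x - t = 0 by rwa [sub_eq_zero.mp this]
    refine hausN.eq_zero_of_forall_exists_pow_smul fun k => ?_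
    obtain ⟨s, hs, v, hsv⟩ := hx (c + k)
    have : s - t = 0 := by
      refine inter (y := y - f ^ k • v) (sub_mem hs ht) ?_
      rw [smul_sub, smul_smul, ← pow_add, sub_eq_sub_iff_add_eq_add, add_comm, ← hty, hsv]
    refine ⟨f ^ c • v, ?_⟩
    rw [← sub_eq_zero.mp this, hsv, smul_smul, ← pow_add, add_comm k c]
    abel
  refine ⟨?_, ?_, ?_⟩
  · refine (injective_iff_map_eq_zero (LinearMap.lsmul A (A ⧸ T) f)).mpr fun y hy => ?_
    obtain ⟨a, rfl⟩ := Ideal.Quotient.mk_surjective y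
    change Ideal.Quotient.mk T (f * a) = 0 at hy
    rw [Ideal.Quotient.eq_zero_iff_mem, hT, Submodule.mem_torsionBy_iff] at hy
    refine Ideal.Quotient.eq_zero_iff_mem.mpr (memT (c + 1) ?_)
    rw [pow_succ, mul_assoc]
    exact hy
  · refine (injective_iff_map_eq_zero (LinearMap.lsmul A ((A ⧸ T) ⊗[A] N) f)).mpr fun y hy => ?_
    obtain ⟨x, rfl⟩ := TensorProduct.mk_quotient_one_surjective T y
    rw [LinearMap.lsmul_apply, ← map_smul, TensorProduct.mk_apply,
      TensorProduct.one_tmul_eq_zero_iff_mem_smul_top] at hy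
    rw [TensorProduct.mk_apply, TensorProduct.one_tmul_eq_zero_iff_mem_smul_top]
    exact closed fun k => approx (c + 1) k x (by rw [pow_succ, mul_smul, killed hy])
  · have : IsPrecomplete (Ideal.span {f}) ((A ⧸ T) ⊗[A] N) :=
      .of_surjective _ (TensorProduct.mk_quotient_one_surjective T)
    have : IsHausdorff (Ideal.span {f}) ((A ⧸ T) ⊗[A] N) := by
      refine ⟨fun y hy => ?_⟩
      obtain ⟨x, rfl⟩ := TensorProduct.mk_quotient_one_surjective T y
      rw [TensorProduct.mk_apply, TensorProduct.one_tmul_eq_zero_iff_mem_smul_top]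
      refine closed fun k => ?_
      obtain ⟨w, hw⟩ := Submodule.mem_span_singleton_pow_smul_top.mp (SModEq.zero.mp (hy k))
      obtain ⟨v, rfl⟩ := TensorProduct.mk_quotient_one_surjective T w
      rw [← map_smul, eq_comm, ← sub_eq_zero, ← map_sub, TensorProduct.mk_apply,
        TensorProduct.one_tmul_eq_zero_iff_mem_smul_top] at hw
      exact ⟨_, hw, v, by abel⟩
    exact {}
end

section
/- Let A be a commutative ring and ξ, f ∈ A nonzerodivisors such that A is derived ξ-complete and derived f-complete, and such that A/ξA has bounded f^∞-torsion. Put J = (ξ, f). Let N be an A-module which is J-adically complete and such that N/J^nN is a flat A/J^n-module for every n ≥ 1. Then Tor_i^A(N, A/J) = 0 for all i ≥ 1 (i.e. N is J-completely flat), and N is derived J-complete. If in addition each N/J^nN is faithfully flat over A/J^n, then N/JN is faithfully flat over A/J. -/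
open TensorProduct CategoryTheory

universe u

section Defs
variable (A : Type u) [CommRing A]

/-- `M` is derived `f`-complete: `Hom_A(A_f, M) = 0` and `Ext¹_A(A_f, M) = 0`,
where `A_f = A[1/f]`. -/
noncomputable def DerivedComplete (f : A) (M : Type u) [AddCommGroup M] [Module A M] : Prop :=
  (∀ g : Localization.Away f →ₗ[A] M, g = 0) ∧
  Subsingleton (((Ext A (ModuleCat.{u} A) 1).obj
      (Opposite.op (ModuleCat.of A (Localization.Away f)))).obj (ModuleCat.of A M))

/-- `Tor_i^A(M, N) = 0` for all `i ≥ 1`. -/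
noncomputable def TorVanish (M N : Type u) [AddCommGroup M] [Module A M]
    [AddCommGroup N] [Module A N] : Prop :=
  ∀ i : ℕ, 1 ≤ i →
    Subsingleton (((Tor (ModuleCat.{u} A) i).obj (ModuleCat.of A M)).obj (ModuleCat.of A N))

end Defs

section TorSyzygy

variable {A : Type u} [CommRing A]

/-- The first syzygy of `N`: the kernel of the canonical free cover `(N →₀ A) → N`. -/
def FreeSyzygy (A : Type u) [CommRing A] (N : Type u) [AddCommGroup N] [Module A N] : Type u :=
  LinearMap.ker (Finsupp.linearCombination A (id : N → N))

namespace FreeSyzygy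

variable (A) (N : Type u) [AddCommGroup N] [Module A N]

noncomputable instance : AddCommGroup (FreeSyzygy A N) :=
  inferInstanceAs (AddCommGroup (LinearMap.ker (Finsupp.linearCombination A (id : N → N))))

noncomputable instance : Module A (FreeSyzygy A N) :=
  inferInstanceAs (Module A (LinearMap.ker (Finsupp.linearCombination A (id : N → N))))

/-- The canonical free cover of `N`. -/
noncomputable def cover : (N →₀ A) →ₗ[A] N := Finsupp.linearCombination A id

/-- The inclusion of the first syzygy in the canonical free cover. -/
noncomputable def incl : FreeSyzygy A N →ₗ[A] (N →₀ A) :=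
  (LinearMap.ker (Finsupp.linearCombination A (id : N → N))).subtype

lemma incl_injective : Function.Injective (incl A N) :=
  (LinearMap.ker (Finsupp.linearCombination A (id : N → N))).subtype_injective

lemma cover_surjective : Function.Surjective (cover A N) :=
  Finsupp.linearCombination_id_surjective A N

lemma exact : Function.Exact (incl A N) (cover A N) :=
  LinearMap.exact_subtype_ker_map _

end FreeSyzygy

/-- Vanishing of `Tor_{n+1}(N, M)`, expressed through iterated syzygies of `N`. -/
def SyzygyTorVanish (A : Type u) [CommRing A] (M : Type u) [AddCommGroup M] [Module A M] :
    ∀ (_ : ℕ) (N : Type u) [AddCommGroup N] [Module A N], Prop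
  | 0, N, _, _ => Function.Injective ((FreeSyzygy.incl A N).rTensor M)
  | n + 1, N, _, _ => SyzygyTorVanish A M n (FreeSyzygy A N)

lemma SyzygyTorVanish.self (n : ℕ) (N : Type u) [AddCommGroup N] [Module A N] :
    SyzygyTorVanish A A n N := by
  induction n generalizing N with
  | zero => exact Module.Flat.rTensor_preserves_injective_linearMap _ (FreeSyzygy.incl_injective A N)
  | succ n ih => exact ih _

lemma SyzygyTorVanish.finsupp (n : ℕ) (N : Type u) [AddCommGroup N] [Module A N]
    {M : Type u} [AddCommGroup M] [Module A M] (ι : Type u) (h : SyzygyTorVanish A M n N) :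
    SyzygyTorVanish A (ι →₀ M) n N := by
  classical
  induction n generalizing N with
  | zero =>
    have key : ((TensorProduct.finsuppRight A A (N →₀ A) M ι).toLinearMap ∘ₗ
          (FreeSyzygy.incl A N).rTensor (ι →₀ M)) =
        Finsupp.mapRange.linearMap ((FreeSyzygy.incl A N).rTensor M) ∘ₗ
          (TensorProduct.finsuppRight A A (FreeSyzygy A N) M ι).toLinearMap := by
      ext
      simp
    have hinj : Function.Injective ((TensorProduct.finsuppRight A A (N →₀ A) M ι).toLinearMap ∘ₗ
          (FreeSyzygy.incl A N).rTensor (ι →₀ M)) := by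
      rw [key]
      exact (Finsupp.mapRange_injective _ (map_zero _) h).comp
        (TensorProduct.finsuppRight A A (FreeSyzygy A N) M ι).injective
    rw [LinearMap.coe_comp] at hinj
    exact hinj.of_comp
  | succ n ih => exact ih _ h

section Exact

variable {M₁ M₂ M₃ : Type u} [AddCommGroup M₁] [Module A M₁] [AddCommGroup M₂] [Module A M₂]
  [AddCommGroup M₃] [Module A M₃] {i : M₁ →ₗ[A] M₂} {p : M₂ →ₗ[A] M₃}

lemma LinearMap.rTensor_lTensor_comm {P Q S T : Type u} [AddCommGroup P] [Module A P]
    [AddCommGroup Q] [Module A Q] [AddCommGroup S] [Module A S] [AddCommGroup T] [Module A T]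
    (g : P →ₗ[A] Q) (k : S →ₗ[A] T) (x : P ⊗[A] S) :
    g.rTensor T (k.lTensor P x) = k.lTensor Q (g.rTensor S x) := by
  rw [← LinearMap.comp_apply, ← LinearMap.comp_apply, LinearMap.rTensor_comp_lTensor,
    LinearMap.lTensor_comp_rTensor]

lemma LinearMap.rTensor_injective_of_exact_of_exact {L P N : Type u}
    [AddCommGroup L] [Module A L] [AddCommGroup P] [Module A P] [AddCommGroup N] [Module A N]
    {j : L →ₗ[A] P} {q : P →ₗ[A] N} (hq : Function.Surjective q) (hjq : Function.Exact j q)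
    (hp : Function.Surjective p) (hip : Function.Exact i p)
    (hN : Function.Injective (i.lTensor N)) (h : Function.Injective (j.rTensor M₂)) :
    Function.Injective (j.rTensor M₃) := by
  refine (injective_iff_map_eq_zero _).2 fun x hx => ?_
  obtain ⟨x, rfl⟩ := LinearMap.lTensor_surjective L hp x
  rw [LinearMap.rTensor_lTensor_comm] at hx
  obtain ⟨y, hy⟩ := (lTensor_exact P hip hp _).1 hx
  have hy0 : q.rTensor M₁ y = 0 := by
    apply hN
    rw [map_zero, ← LinearMap.rTensor_lTensor_comm, hy, ← LinearMap.comp_apply,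
      ← LinearMap.rTensor_comp, hjq.linearMap_comp_eq_zero]
    simp
  obtain ⟨z, rfl⟩ := (rTensor_exact M₁ hjq hq _).1 hy0
  rw [← LinearMap.rTensor_lTensor_comm] at hy
  rw [← h hy, ← LinearMap.comp_apply, ← LinearMap.lTensor_comp, hip.linearMap_comp_eq_zero]
  simp

lemma SyzygyTorVanish.zero_of_exact (hp : Function.Surjective p)
    (hip : Function.Exact i p) (N : Type u) [AddCommGroup N] [Module A N]
    (hN : Function.Injective (i.lTensor N)) (h : SyzygyTorVanish A M₂ 0 N) :
    SyzygyTorVanish A M₃ 0 N :=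
  LinearMap.rTensor_injective_of_exact_of_exact (FreeSyzygy.cover_surjective A N)
    (FreeSyzygy.exact A N) hp hip hN h

lemma SyzygyTorVanish.succ_of_exact (hi : Function.Injective i) (hp : Function.Surjective p)
    (hip : Function.Exact i p) (n : ℕ) (N : Type u) [AddCommGroup N] [Module A N]
    (h₁ : SyzygyTorVanish A M₁ n N) (h₂ : SyzygyTorVanish A M₂ (n + 1) N) :
    SyzygyTorVanish A M₃ (n + 1) N := by
  induction n generalizing N with
  | zero =>
    refine SyzygyTorVanish.zero_of_exact hp hip (FreeSyzygy A N) ?_ h₂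
    refine Function.Injective.of_comp (f := (FreeSyzygy.incl A N).rTensor M₂) ?_
    rw [← LinearMap.coe_comp, LinearMap.rTensor_comp_lTensor, ← LinearMap.lTensor_comp_rTensor,
      LinearMap.coe_comp]
    exact (Module.Flat.lTensor_preserves_injective_linearMap _ hi).comp h₁
  | succ n ih => exact ih _ h₁ h₂

end Exact

lemma LinearMap.lTensor_comp_eq_zero_of_exact {M₁ M₂ M₃ : Type u} [AddCommGroup M₁] [Module A M₁]
    [AddCommGroup M₂] [Module A M₂] [AddCommGroup M₃] [Module A M₃] {i : M₁ →ₗ[A] M₂}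
    {p : M₂ →ₗ[A] M₃} (hip : Function.Exact i p) (N : Type u) [AddCommGroup N] [Module A N]
    (x : N ⊗[A] M₁) : p.lTensor N (i.lTensor N x) = 0 := by
  rw [← LinearMap.comp_apply, ← LinearMap.lTensor_comp, hip.linearMap_comp_eq_zero]
  simp

lemma LinearMap.exact_lTensor_of_flat_cover {L P N : Type u}
    [AddCommGroup L] [Module A L] [AddCommGroup P] [Module A P] [AddCommGroup N] [Module A N]
    [Module.Flat A P] {j : L →ₗ[A] P} {q : P →ₗ[A] N} (hq : Function.Surjective q)
    (hjq : Function.Exact j q) {X₂ X₁ X₀ : Type u} [AddCommGroup X₂] [Module A X₂]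
    [AddCommGroup X₁] [Module A X₁] [AddCommGroup X₀] [Module A X₀]
    {d₂ : X₂ →ₗ[A] X₁} {d₁ : X₁ →ₗ[A] X₀} (hd : Function.Exact d₂ d₁)
    (hL : ∀ (w : L ⊗[A] X₀) (v : P ⊗[A] X₁), j.rTensor X₀ w = d₁.lTensor P v →
      ∃ y, d₁.lTensor L y = w) :
    Function.Exact (d₂.lTensor N) (d₁.lTensor N) := by
  refine fun x => ⟨fun hx => ?_, ?_⟩
  · obtain ⟨x, rfl⟩ := LinearMap.rTensor_surjective X₁ hq x
    rw [← LinearMap.rTensor_lTensor_comm] at hx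
    obtain ⟨w, hw⟩ := (rTensor_exact X₀ hjq hq _).1 hx
    obtain ⟨y, rfl⟩ := hL w x hw
    rw [LinearMap.rTensor_lTensor_comm, eq_comm, ← sub_eq_zero, ← map_sub] at hw
    obtain ⟨z, hz⟩ := (Module.Flat.lTensor_exact P hd _).1 hw
    refine ⟨q.rTensor _ z, ?_⟩
    rw [← LinearMap.rTensor_lTensor_comm, hz, map_sub, sub_eq_self, ← LinearMap.comp_apply,
      ← LinearMap.rTensor_comp, hjq.linearMap_comp_eq_zero]
    simp
  · rintro ⟨y, rfl⟩
    exact LinearMap.lTensor_comp_eq_zero_of_exact hd N y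

lemma SyzygyTorVanish.exact_lTensor {M : Type u} [AddCommGroup M] [Module A M]
    {X : ℕ → Type u} [∀ n, AddCommGroup (X n)] [∀ n, Module A (X n)] [∀ n, Module.Flat A (X n)]
    {d : ∀ n, X (n + 1) →ₗ[A] X n} {ε : X 0 →ₗ[A] M} (hε : Function.Surjective ε)
    (hd₀ : Function.Exact (d 0) ε) (hd : ∀ n, Function.Exact (d (n + 1)) (d n))
    (n : ℕ) (N : Type u) [AddCommGroup N] [Module A N] (h : SyzygyTorVanish A M n N) :
    Function.Exact ((d (n + 1)).lTensor N) ((d n).lTensor N) := by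
  induction n generalizing N with
  | zero =>
    refine LinearMap.exact_lTensor_of_flat_cover (FreeSyzygy.cover_surjective A N)
      (FreeSyzygy.exact A N) (hd 0) fun w v hv => (lTensor_exact (FreeSyzygy A N) hd₀ hε w).1 (h ?_)
    rw [LinearMap.rTensor_lTensor_comm, hv, map_zero]
    exact LinearMap.lTensor_comp_eq_zero_of_exact hd₀ _ v
  | succ n ih =>
    refine LinearMap.exact_lTensor_of_flat_cover (FreeSyzygy.cover_surjective A N)
      (FreeSyzygy.exact A N) (hd (n + 1)) fun w v hv => (ih (FreeSyzygy A N) h w).1 ?_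
    apply Module.Flat.rTensor_preserves_injective_linearMap (M := X n) _
      (FreeSyzygy.incl_injective A N)
    rw [LinearMap.rTensor_lTensor_comm, hv, map_zero]
    exact LinearMap.lTensor_comp_eq_zero_of_exact (hd n) _ v

lemma ModuleCat.exact_iff_function_exact (S : ShortComplex (ModuleCat.{u} A)) :
    S.Exact ↔ Function.Exact S.f.hom S.g.hom :=
  CategoryTheory.ShortComplex.ShortExact.moduleCat_exact_iff_function_exact S

lemma SyzygyTorVanish.subsingleton_tor {M : Type u} [AddCommGroup M] [Module A M]
    (n : ℕ) (N : Type u) [AddCommGroup N] [Module A N] (h : SyzygyTorVanish A M n N) :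
    Subsingleton (((Tor (ModuleCat.{u} A) (n + 1)).obj (ModuleCat.of A N)).obj
      (ModuleCat.of A M)) := by
  let P := projectiveResolution (ModuleCat.of A M)
  let F := (MonoidalCategory.tensoringLeft (ModuleCat.{u} A)).obj (ModuleCat.of A N)
  have hflat (n : ℕ) : Module.Flat A (P.complex.X n) := by
    have : Module.Projective A (P.complex.X n) :=
      (IsProjective.iff_projective _).2 (P.projective n)
    infer_instance
  have hε : Function.Surjective (P.π.f 0).hom := (ModuleCat.epi_iff_surjective _).1 inferInstance
  have hd₀ := (ModuleCat.exact_iff_function_exact _).1 P.exact₀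
  have hd (n : ℕ) := (ModuleCat.exact_iff_function_exact _).1 (P.exact_succ n)
  have key := SyzygyTorVanish.exact_lTensor (X := fun n => P.complex.X n)
    (d := fun n => (P.complex.d (n + 1) n).hom) (ε := (P.π.f 0).hom) hε hd₀ hd n N h
  refine ModuleCat.subsingleton_of_isZero (Limits.IsZero.of_iso ?_ (P.isoLeftDerivedObj F (n + 1)))
  change Limits.IsZero (HomologicalComplex.homology _ _)
  rw [← HomologicalComplex.exactAt_iff_isZero_homology,
    HomologicalComplex.exactAt_iff' _ (n + 2) (n + 1) n (by simp) (by simp),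
    ModuleCat.exact_iff_function_exact]
  exact key

section Assembly

variable (ξ f : A)

/-- Multiplication by `f ^ m` on `A ⧸ (ξ)`. -/
noncomputable abbrev mulPowQuot (m : ℕ) : (A ⧸ Ideal.span {ξ}) →ₗ[A] (A ⧸ Ideal.span {ξ}) :=
  LinearMap.lsmul A (A ⧸ Ideal.span {ξ}) (f ^ m)

variable {ξ f}

lemma smul_quot_span_singleton (x : A ⧸ Ideal.span {ξ}) : ξ • x = 0 := by
  obtain ⟨x, rfl⟩ := Ideal.Quotient.mk_surjective x
  rw [← Ideal.Quotient.mk_eq_mk, ← Submodule.Quotient.mk_smul, Submodule.Quotient.mk_eq_zero]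
  exact Ideal.mul_mem_right _ _ (Ideal.mem_span_singleton_self ξ)

/-- The map from `A ⧸ (ξ, f ^ m)` to `M` determined by an element of a module killed by
`ξ` and `f ^ m`. -/
noncomputable def mulPowQuotLift {m : ℕ} {M : Type u} [AddCommGroup M] [Module A M]
    (hMξ : ∀ x : M, ξ • x = 0) (hMf : ∀ x : M, f ^ m • x = 0) (x : M) :
    ((A ⧸ Ideal.span {ξ}) ⧸ LinearMap.range (mulPowQuot ξ f m)) →ₗ[A] M :=
  Submodule.liftQ _ (Submodule.liftQ (Ideal.span {ξ}) (LinearMap.toSpanSingleton A M x) (by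
    rw [Ideal.span, Submodule.span_singleton_le_iff_mem]
    simpa using hMξ x)) (by
    rintro _ ⟨y, rfl⟩
    rw [LinearMap.mem_ker, LinearMap.lsmul_apply, map_smul]
    exact hMf _)

lemma mulPowQuotLift_one {m : ℕ} {M : Type u} [AddCommGroup M] [Module A M]
    (hMξ : ∀ x : M, ξ • x = 0) (hMf : ∀ x : M, f ^ m • x = 0) (x : M) :
    mulPowQuotLift hMξ hMf x (Submodule.Quotient.mk (Submodule.Quotient.mk 1)) = x := by
  exact one_smul A x

variable {N : Type u} [AddCommGroup N] [Module A N]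

lemma SyzygyTorVanish.quot_span_singleton (hξ : ξ ∈ nonZeroDivisors A)
    (hN : ∀ x : N, ξ • x = 0 → x = 0) (n : ℕ) :
    SyzygyTorVanish A (A ⧸ Ideal.span {ξ}) n N := by
  have hi : Function.Injective (LinearMap.lsmul A A ξ) := by
    refine (injective_iff_map_eq_zero _).2 fun x hx => ?_
    rw [LinearMap.lsmul_apply, smul_eq_mul, mul_comm] at hx
    exact (mem_nonZeroDivisors_iff_right.1 hξ) x hx
  have hip : Function.Exact (LinearMap.lsmul A A ξ) (Submodule.mkQ (Ideal.span {ξ})) := by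
    intro x
    rw [Submodule.mkQ_apply, Submodule.Quotient.mk_eq_zero, Ideal.mem_span_singleton']
    simp [mul_comm]
  cases n with
  | zero =>
    refine SyzygyTorVanish.zero_of_exact (Submodule.mkQ_surjective _) hip N ?_ (.self 0 N)
    have : (LinearMap.lsmul A A ξ).lTensor N = LinearMap.lsmul A (N ⊗[A] A) ξ := by
      ext x
      simp [← TensorProduct.tmul_smul]
    rw [this]
    refine (injective_iff_map_eq_zero _).2 fun x hx => ?_
    apply (TensorProduct.rid A N).injective
    rw [map_zero]
    apply hN
    rw [← map_smul]
    simpa using congrArg (TensorProduct.rid A N) hx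
  | succ n =>
    exact SyzygyTorVanish.succ_of_exact hi (Submodule.mkQ_surjective _) hip n N
      (.self n N) (.self (n + 1) N)

lemma SyzygyTorVanish.of_smul_eq_zero (hR : ∀ n, SyzygyTorVanish A (A ⧸ Ideal.span {ξ}) n N)
    (hker : ∀ m, Function.Injective ((LinearMap.ker (mulPowQuot ξ f m)).subtype.lTensor N))
    (hrange : ∀ m, Function.Injective ((LinearMap.range (mulPowQuot ξ f m)).subtype.lTensor N))
    (hflat : ∀ (m : ℕ) (M' M : Type u) [AddCommGroup M'] [Module A M'] [AddCommGroup M]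
      [Module A M] (i : M' →ₗ[A] M), Function.Injective i → (∀ x : M, ξ • x = 0) →
      (∀ x : M, f ^ m • x = 0) → Function.Injective (i.lTensor N))
    (n m : ℕ) (M : Type u) [AddCommGroup M] [Module A M]
    (hMξ : ∀ x : M, ξ • x = 0) (hMf : ∀ x : M, f ^ m • x = 0) :
    SyzygyTorVanish A M n N := by
  induction n using Nat.strong_induction_on generalizing M with
  | h n ih =>
  have hrangeTor (k : ℕ) (hk : k ≤ n) :
      SyzygyTorVanish A (LinearMap.range (mulPowQuot ξ f m)) k N := by
    have hex : Function.Exact (LinearMap.ker (mulPowQuot ξ f m)).subtype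
        (mulPowQuot ξ f m).rangeRestrict := by
      rw [LinearMap.exact_iff, LinearMap.ker_rangeRestrict, Submodule.range_subtype]
    have hsurj := (mulPowQuot ξ f m).surjective_rangeRestrict
    cases k with
    | zero => exact SyzygyTorVanish.zero_of_exact hsurj hex N (hker m) (hR 0)
    | succ k =>
      refine SyzygyTorVanish.succ_of_exact (Submodule.subtype_injective _) hsurj hex k N ?_ (hR _)
      refine ih k (by omega) _ (fun x => ?_) (fun x => ?_)
      · exact Subtype.ext (smul_quot_span_singleton _)
      · exact Subtype.ext x.2
  have hquot : SyzygyTorVanish A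
      ((A ⧸ Ideal.span {ξ}) ⧸ LinearMap.range (mulPowQuot ξ f m)) n N := by
    have hex : Function.Exact (LinearMap.range (mulPowQuot ξ f m)).subtype
        (LinearMap.range (mulPowQuot ξ f m)).mkQ := by
      rw [LinearMap.exact_iff, Submodule.ker_mkQ, Submodule.range_subtype]
    have hsurj := (LinearMap.range (mulPowQuot ξ f m)).mkQ_surjective
    cases n with
    | zero => exact SyzygyTorVanish.zero_of_exact hsurj hex N (hrange m) (hR 0)
    | succ n =>
      exact SyzygyTorVanish.succ_of_exact (Submodule.subtype_injective _) hsurj hex n N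
        (hrangeTor n (by omega)) (hR _)
  have hfree := SyzygyTorVanish.finsupp n N M hquot
  have hqξ (x : (A ⧸ Ideal.span {ξ}) ⧸ LinearMap.range (mulPowQuot ξ f m)) : ξ • x = 0 := by
    obtain ⟨x, rfl⟩ := Submodule.Quotient.mk_surjective _ x
    rw [← Submodule.Quotient.mk_smul, smul_quot_span_singleton, Submodule.Quotient.mk_zero]
  have hqf (x : (A ⧸ Ideal.span {ξ}) ⧸ LinearMap.range (mulPowQuot ξ f m)) : f ^ m • x = 0 := by
    obtain ⟨x, rfl⟩ := Submodule.Quotient.mk_surjective _ x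
    rw [← Submodule.Quotient.mk_smul, Submodule.Quotient.mk_eq_zero]
    exact ⟨x, rfl⟩
  let p : (M →₀ (A ⧸ Ideal.span {ξ}) ⧸ LinearMap.range (mulPowQuot ξ f m)) →ₗ[A] M :=
    Finsupp.lsum A fun x => mulPowQuotLift hMξ hMf x
  have hp : Function.Surjective p := fun x =>
    ⟨Finsupp.single x (Submodule.Quotient.mk (Submodule.Quotient.mk 1)), by
      simp only [p, Finsupp.lsum_single, mulPowQuotLift_one]⟩
  have hex : Function.Exact (LinearMap.ker p).subtype p := LinearMap.exact_subtype_ker_map p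
  have hFξ (x : M →₀ (A ⧸ Ideal.span {ξ}) ⧸ LinearMap.range (mulPowQuot ξ f m)) : ξ • x = 0 :=
    Finsupp.ext fun _ => hqξ _
  have hFf (x : M →₀ (A ⧸ Ideal.span {ξ}) ⧸ LinearMap.range (mulPowQuot ξ f m)) :
      f ^ m • x = 0 := Finsupp.ext fun _ => hqf _
  cases n with
  | zero =>
    exact SyzygyTorVanish.zero_of_exact hp hex N
      (hflat m _ _ _ (Submodule.subtype_injective _) hFξ hFf) hfree
  | succ n =>
    exact SyzygyTorVanish.succ_of_exact (Submodule.subtype_injective _) hp hex n N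
      (ih n (by omega) _ (fun x => Subtype.ext (hFξ _)) (fun x => Subtype.ext (hFf _))) hfree

end Assembly

end TorSyzygy

section ColonFlat

variable {A : Type u} [CommRing A] {N : Type u} [AddCommGroup N] [Module A N]

lemma lTensor_injective_of_flat_baseChange (B : Type u) [CommRing B] [Algebra A B]
    [Module.Flat B (B ⊗[A] N)] {M' M : Type u} [AddCommGroup M'] [Module A M'] [Module B M']
    [IsScalarTower A B M'] [AddCommGroup M] [Module A M] [Module B M] [IsScalarTower A B M]
    (i : M' →ₗ[B] M) (hi : Function.Injective i) :
    Function.Injective ((i.restrictScalars A).lTensor N) := by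
  have h := Module.Flat.rTensor_preserves_injective_linearMap (M := B ⊗[A] N) i hi
  have key : (TensorProduct.AlgebraTensorModule.cancelBaseChange A B B M N).toLinearMap ∘ₗ
      i.rTensor (B ⊗[A] N) = (TensorProduct.AlgebraTensorModule.map i LinearMap.id) ∘ₗ
        (TensorProduct.AlgebraTensorModule.cancelBaseChange A B B M' N).toLinearMap := by
    ext; simp
  have hinj : Function.Injective ((i.restrictScalars A).rTensor N) := by
    have h2 := (TensorProduct.AlgebraTensorModule.cancelBaseChange A B B M N).injective.comp h
    rw [← LinearEquiv.coe_toLinearMap, ← LinearMap.coe_comp, key, LinearMap.coe_comp] at h2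
    exact h2.of_comp_right
      (TensorProduct.AlgebraTensorModule.cancelBaseChange A B B M' N).surjective
  rwa [← LinearMap.lTensor_inj_iff_rTensor_inj] at hinj

lemma lTensor_injective_of_flat_quotient (I : Ideal A) [Module.Flat (A ⧸ I) ((A ⧸ I) ⊗[A] N)]
    {M' M : Type u} [AddCommGroup M'] [Module A M'] [AddCommGroup M] [Module A M]
    (i : M' →ₗ[A] M) (hi : Function.Injective i) (hM : ∀ a ∈ I, ∀ x : M, a • x = 0) :
    Function.Injective (i.lTensor N) := by
  have hM1 : Module.IsTorsionBySet A M I := fun x a => hM a a.2 x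
  have hM2 : Module.IsTorsionBySet A M' I := fun x a => hi (by
    rw [map_smul, map_zero]; exact hM a a.2 _)
  let := hM1.module
  let := hM2.module
  have := hM1.isScalarTower (S := A)
  have := hM2.isScalarTower (S := A)
  let j : M' →ₗ[A ⧸ I] M :=
    { toFun := i
      map_add' := map_add i
      map_smul' := fun b x => by
        obtain ⟨b, rfl⟩ := Ideal.Quotient.mk_surjective b
        exact map_smul i b x }
  exact lTensor_injective_of_flat_baseChange (A ⧸ I) j hi

lemma mem_ideal_smul_top_iff_tmul_one (I : Ideal A) (x : N) :
    x ∈ I • (⊤ : Submodule A N) ↔ x ⊗ₜ[A] (1 : A ⧸ I) = 0 := by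
  rw [← Submodule.Quotient.mk_eq_zero,
    ← (TensorProduct.tensorQuotEquivQuotSMul N I).map_eq_zero_iff]
  have := TensorProduct.tensorQuotEquivQuotSMul_tmul_mk I x 1
  rw [one_smul] at this
  rw [← this]
  rfl

/-- Flatness of `N / I₀ N` over `A / I₀` lets division by `a` modulo an ideal `I ⊇ I₀` be
performed in the coefficients. -/
lemma mem_smul_top_of_smul_mem (I₀ I C : Ideal A) [Module.Flat (A ⧸ I₀) ((A ⧸ I₀) ⊗[A] N)]
    (hI : I₀ ≤ I) (a : A) (hC : ∀ b, a * b ∈ I ↔ b ∈ C) {x : N}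
    (hx : a • x ∈ I • (⊤ : Submodule A N)) : x ∈ C • (⊤ : Submodule A N) := by
  let ψ : (A ⧸ C) →ₗ[A] (A ⧸ I) :=
    Submodule.mapQ C I (LinearMap.lsmul A A a) fun b hb => (hC b).2 hb
  have hψ : Function.Injective ψ := by
    refine (injective_iff_map_eq_zero _).2 fun b hb => ?_
    obtain ⟨b, rfl⟩ := Submodule.Quotient.mk_surjective _ b
    rw [Submodule.Quotient.mk_eq_zero]
    exact (hC b).1 ((Submodule.Quotient.mk_eq_zero _).1 hb)
  have h := lTensor_injective_of_flat_quotient (N := N) I₀ ψ hψ fun b hb y => by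
    obtain ⟨y, rfl⟩ := Submodule.Quotient.mk_surjective _ y
    rw [← Submodule.Quotient.mk_smul, Submodule.Quotient.mk_eq_zero]
    exact Ideal.mul_mem_right _ _ (hI hb)
  rw [mem_ideal_smul_top_iff_tmul_one] at hx ⊢
  apply h
  rw [map_zero, LinearMap.lTensor_tmul, ← hx]
  have : ψ 1 = a • (1 : A ⧸ I) := rfl
  rw [this, TensorProduct.smul_tmul]

end ColonFlat
section TwoGenerators

variable {A : Type u} [CommRing A] {ξ f : A}

lemma exists_eq_of_mem_span_pair_pow {n : ℕ} {a : A} (ha : a ∈ Ideal.span {ξ, f} ^ (n + 1)) :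
    ∃ b, ∃ j ∈ Ideal.span {ξ, f} ^ n, a = f ^ (n + 1) * b + ξ * j := by
  induction n generalizing a with
  | zero =>
    rw [zero_add, pow_one, Ideal.mem_span_pair] at ha
    obtain ⟨p, q, rfl⟩ := ha
    exact ⟨q, p, by simp, by ring⟩
  | succ n ih =>
    rw [pow_succ'] at ha
    refine Submodule.mul_induction_on ha ?_ ?_
    · intro u hu v hv
      obtain ⟨p, q, rfl⟩ := Ideal.mem_span_pair.1 hu
      obtain ⟨b, j, hj, hbj⟩ := ih hv
      refine ⟨q * b, p * v + f * (q * j), ?_, by rw [hbj]; ring⟩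
      refine add_mem (Ideal.mul_mem_left _ _ hv) ?_
      rw [pow_succ']
      exact Ideal.mul_mem_mul (Ideal.subset_span (by simp)) (Ideal.mul_mem_left _ _ hj)
    · rintro _ _ ⟨b, j, hj, rfl⟩ ⟨b', j', hj', rfl⟩
      exact ⟨b + b', j + j', add_mem hj hj', by ring⟩

lemma span_pair_pow_le (n : ℕ) : Ideal.span {ξ, f} ^ n ≤ Ideal.span {ξ, f ^ n} := by
  cases n with
  | zero => simp [Ideal.span_insert]
  | succ n =>
    intro a ha
    obtain ⟨b, j, -, rfl⟩ := exists_eq_of_mem_span_pair_pow ha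
    exact Ideal.mem_span_pair.2 ⟨j, b, by ring⟩

lemma pow_mem_span_pair_pow (n : ℕ) : f ^ n ∈ Ideal.span {ξ, f} ^ n :=
  Ideal.pow_mem_pow (Ideal.subset_span (by simp)) n

lemma mem_span_pair_pow_of_mul_mem {c : ℕ} (hξ : ξ ∈ nonZeroDivisors A)
    (hc : ∀ a : A, (∃ n : ℕ, f ^ n * a ∈ Ideal.span {ξ}) → f ^ c * a ∈ Ideal.span {ξ})
    {n : ℕ} {a : A} (ha : ξ * a ∈ Ideal.span {ξ, f} ^ n) :
    a ∈ Ideal.span {ξ, f} ^ (n - (c + 1)) := by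
  rcases le_or_gt n c with h | h
  · rw [Nat.sub_eq_zero_of_le (by omega)]
    simp
  obtain ⟨k, rfl⟩ : ∃ k, n = c + k + 1 := ⟨n - c - 1, by omega⟩
  obtain ⟨b, j, hj, hab⟩ := exists_eq_of_mem_span_pair_pow ha
  obtain ⟨b', hb'⟩ := Ideal.mem_span_singleton'.1 (hc b ⟨c + k + 1,
    Ideal.mem_span_singleton'.2 ⟨a - j, by linear_combination hab⟩⟩)
  have hz : (a - (f ^ (k + 1) * b' + j)) * ξ = 0 := by
    linear_combination hab - f ^ (k + 1) * hb'
  rw [sub_eq_zero.1 ((mem_nonZeroDivisors_iff_right.1 hξ) _ hz)]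
  have hk : c + k + 1 - (c + 1) = k := by omega
  rw [hk]
  refine add_mem (Ideal.mul_mem_right _ _ ?_) (Ideal.pow_le_pow_right (by omega) hj)
  exact Ideal.pow_le_pow_right (by omega) (pow_mem_span_pair_pow (k + 1))

variable {N : Type u} [AddCommGroup N] [Module A N]

lemma smul_mem_of_mem_smul_top {C I : Ideal A} {a : A} (h : ∀ b ∈ C, a * b ∈ I) {x : N}
    (hx : x ∈ C • (⊤ : Submodule A N)) : a • x ∈ I • (⊤ : Submodule A N) := by
  induction hx using Submodule.smul_induction_on' with
  | smul b hb y hy =>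
    rw [smul_smul]
    exact Submodule.smul_mem_smul (h b hb) hy
  | add y hy z hz h₁ h₂ =>
    rw [smul_add]
    exact add_mem h₁ h₂

lemma mem_span_singleton_smul_top {g : A} {x : N} :
    x ∈ Ideal.span {g} • (⊤ : Submodule A N) ↔ ∃ w : N, x = g • w := by
  rw [Submodule.ideal_span_singleton_smul, Submodule.mem_smul_pointwise_iff_exists]
  simp [eq_comm]

lemma mem_span_pair_smul_top {g h : A} {x : N} :
    x ∈ Ideal.span {g, h} • (⊤ : Submodule A N) ↔ ∃ w v : N, x = g • w + h • v := by
  rw [Ideal.span_insert, Submodule.sup_smul, Submodule.mem_sup]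
  simp only [mem_span_singleton_smul_top]
  constructor
  · rintro ⟨_, ⟨w, rfl⟩, _, ⟨v, rfl⟩, rfl⟩
    exact ⟨w, v, rfl⟩
  · rintro ⟨w, v, rfl⟩
    exact ⟨_, ⟨w, rfl⟩, _, ⟨v, rfl⟩, rfl⟩

lemma eq_zero_of_forall_mem_pow_smul (J : Ideal A) [IsHausdorff J N] {x : N}
    (h : ∀ n : ℕ, x ∈ J ^ n • (⊤ : Submodule A N)) : x = 0 :=
  IsHausdorff.haus ‹_› x fun n => SModEq.zero.2 (h n)

lemma mem_pow_smul_top_of_le {J : Ideal A} {m n : ℕ} (h : m ≤ n) {x : N}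
    (hx : x ∈ J ^ n • (⊤ : Submodule A N)) : x ∈ J ^ m • (⊤ : Submodule A N) :=
  Submodule.smul_mono_left (Ideal.pow_le_pow_right h) hx

variable {c : ℕ} (hξ : ξ ∈ nonZeroDivisors A)
  (hc : ∀ a : A, (∃ n : ℕ, f ^ n * a ∈ Ideal.span {ξ}) → f ^ c * a ∈ Ideal.span {ξ})
  (hflat : ∀ n : ℕ, 1 ≤ n →
    Module.Flat (A ⧸ (Ideal.span {ξ, f} ^ n)) ((A ⧸ (Ideal.span {ξ, f} ^ n)) ⊗[A] N))

include hξ hc hflat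

lemma mem_pow_smul_top_of_smul_mem {n : ℕ} {x : N}
    (hx : ξ • x ∈ Ideal.span {ξ, f} ^ n • (⊤ : Submodule A N)) :
    x ∈ Ideal.span {ξ, f} ^ (n - (c + 1)) • (⊤ : Submodule A N) := by
  rcases Nat.eq_zero_or_pos n with rfl | hn
  · simp
  have := hflat n hn
  have h := mem_smul_top_of_smul_mem (Ideal.span {ξ, f} ^ n) (Ideal.span {ξ, f} ^ n)
    (Submodule.comap (LinearMap.lsmul A A ξ) (Ideal.span {ξ, f} ^ n)) le_rfl ξ
    (fun _ => Iff.rfl) hx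
  exact Submodule.smul_mono_left (fun a ha => mem_span_pair_pow_of_mul_mem hξ hc ha) h

lemma eq_zero_of_smul_eq_zero [IsHausdorff (Ideal.span {ξ, f}) N] {x : N} (hx : ξ • x = 0) :
    x = 0 := by
  refine eq_zero_of_forall_mem_pow_smul (Ideal.span {ξ, f}) fun n => ?_
  have h := mem_pow_smul_top_of_smul_mem hξ hc hflat (n := n + (c + 1)) (x := x)
    (by rw [hx]; exact zero_mem _)
  rwa [Nat.add_sub_cancel] at h

lemma exists_eq_smul_of_forall [IsAdicComplete (Ideal.span {ξ, f}) N] {y : N}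
    (hy : ∀ n : ℕ, ∃ x : N, y - ξ • x ∈ Ideal.span {ξ, f} ^ n • (⊤ : Submodule A N)) :
    ∃ x : N, y = ξ • x := by
  choose x hx using hy
  obtain ⟨z, hz⟩ := IsPrecomplete.prec (I := Ideal.span {ξ, f}) (M := N) inferInstance
    (f := fun n => x (n + (c + 1))) fun {m n} hmn => by
      rw [SModEq.sub_mem]
      have h := mem_pow_smul_top_of_smul_mem hξ hc hflat (n := m + (c + 1))
        (x := x (m + (c + 1)) - x (n + (c + 1))) (by
          have := sub_mem (mem_pow_smul_top_of_le (by omega) (hx (n + (c + 1))))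
            (hx (m + (c + 1)))
          convert this using 1
          rw [smul_sub]; abel)
      rwa [Nat.add_sub_cancel] at h
  refine ⟨z, sub_eq_zero.1 (eq_zero_of_forall_mem_pow_smul (Ideal.span {ξ, f}) fun n => ?_)⟩
  have h₁ := Submodule.smul_mem _ ξ (SModEq.sub_mem.1 (hz n))
  have h₂ := mem_pow_smul_top_of_le (m := n) (by omega) (hx (n + (c + 1)))
  convert add_mem h₁ h₂ using 1
  rw [smul_sub]; abel

lemma exists_pow_smul_eq [IsAdicComplete (Ideal.span {ξ, f}) N] {k : ℕ} {x : N}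
    (hx : ∃ w : N, f ^ k • x = ξ • w) : ∃ w : N, f ^ c • x = ξ • w := by
  refine exists_eq_smul_of_forall hξ hc hflat fun m => ?_
  obtain ⟨w, hw⟩ := hx
  have := hflat (k + m + 1) (by omega)
  have h := mem_smul_top_of_smul_mem (N := N) (Ideal.span {ξ, f} ^ (k + m + 1))
    (Ideal.span {ξ, f ^ (k + m + 1)})
    (Submodule.comap (LinearMap.lsmul A A (f ^ k)) (Ideal.span {ξ, f ^ (k + m + 1)}))
    (span_pair_pow_le _) (f ^ k) (fun _ => Iff.rfl) (x := x)
    (mem_span_pair_smul_top.2 ⟨w, 0, by rw [hw, smul_zero, add_zero]⟩)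
  have h' := smul_mem_of_mem_smul_top (a := f ^ c) (I := Ideal.span {ξ, f ^ m}) (fun b hb => by
    obtain ⟨p, q, hpq⟩ := Ideal.mem_span_pair.1 hb
    simp only [LinearMap.lsmul_apply, smul_eq_mul] at hpq
    obtain ⟨r, hr⟩ := Ideal.mem_span_singleton'.1 (hc (b - f ^ (m + 1) * q)
      ⟨k, Ideal.mem_span_singleton'.2 ⟨p, by linear_combination hpq⟩⟩)
    exact Ideal.mem_span_pair.2 ⟨r, f ^ c * f * q, by linear_combination hr⟩) h
  obtain ⟨u, v, huv⟩ := mem_span_pair_smul_top.1 h'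
  refine ⟨u, ?_⟩
  rw [huv, add_sub_cancel_left]
  exact Submodule.smul_mem_smul (pow_mem_span_pair_pow m) trivial

lemma mem_smul_top_of_pow_smul_eq [IsAdicComplete (Ideal.span {ξ, f}) N] {m : ℕ} {x : N}
    (hx : ∃ w : N, f ^ m • x = ξ • w) :
    x ∈ Submodule.comap (LinearMap.lsmul A A (f ^ m)) (Ideal.span {ξ}) •
      (⊤ : Submodule A N) := by
  set K : Ideal A := Submodule.comap (LinearMap.lsmul A A (f ^ m)) (Ideal.span {ξ}) with hK
  obtain ⟨w, hw⟩ := hx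
  have := hflat (m + c + 1) (by omega)
  have h := mem_smul_top_of_smul_mem (N := N) (Ideal.span {ξ, f} ^ (m + c + 1))
    (Ideal.span {ξ, f ^ (m + c + 1)})
    (Submodule.comap (LinearMap.lsmul A A (f ^ m)) (Ideal.span {ξ, f ^ (m + c + 1)}))
    (span_pair_pow_le _) (f ^ m) (fun _ => Iff.rfl) (x := x)
    (mem_span_pair_smul_top.2 ⟨w, 0, by rw [hw, smul_zero, add_zero]⟩)
  have hle : Submodule.comap (LinearMap.lsmul A A (f ^ m)) (Ideal.span {ξ, f ^ (m + c + 1)}) ≤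
      K ⊔ Ideal.span {f ^ (c + 1)} := fun b hb => by
    obtain ⟨p, q, hpq⟩ := Ideal.mem_span_pair.1 hb
    simp only [LinearMap.lsmul_apply, smul_eq_mul] at hpq
    refine Submodule.mem_sup.2 ⟨b - f ^ (c + 1) * q, Ideal.mem_span_singleton'.2 ⟨p, ?_⟩,
      f ^ (c + 1) * q, Ideal.mem_span_singleton'.2 ⟨q, by ring⟩, by ring⟩
    simp only [LinearMap.lsmul_apply, smul_eq_mul]
    linear_combination hpq
  have h' := Submodule.smul_mono_left hle h
  rw [Submodule.sup_smul, Submodule.mem_sup] at h'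
  obtain ⟨z, hz, _, hy, rfl⟩ := h'
  obtain ⟨y, rfl⟩ := mem_span_singleton_smul_top.1 hy
  obtain ⟨u, hu⟩ := mem_span_singleton_smul_top.1
    (smul_mem_of_mem_smul_top (a := f ^ m) (I := Ideal.span {ξ}) (fun b hb => hb) hz)
  obtain ⟨v, hv⟩ := exists_pow_smul_eq hξ hc hflat (k := m + (c + 1)) (x := y)
    ⟨w - u, by rw [pow_add, mul_smul, smul_sub, ← hw, ← hu, smul_add, add_sub_cancel_left]⟩
  refine add_mem hz ?_
  rw [pow_succ', mul_smul, hv, smul_comm]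
  refine Submodule.smul_mem_smul ?_ trivial
  rw [hK, Submodule.mem_comap]
  exact Ideal.mul_mem_left _ _ (Ideal.mem_span_singleton_self ξ)

end TwoGenerators

section Completeness

variable {A : Type u} [CommRing A] {ξ f : A} {N : Type u} [AddCommGroup N] [Module A N] {c : ℕ}

lemma lTensor_subtype_ker_mulPowQuot_injective
    (hc : ∀ a : A, (∃ n : ℕ, f ^ n * a ∈ Ideal.span {ξ}) → f ^ c * a ∈ Ideal.span {ξ})
    (hflat : ∀ n : ℕ, 1 ≤ n →
      Module.Flat (A ⧸ (Ideal.span {ξ, f} ^ n)) ((A ⧸ (Ideal.span {ξ, f} ^ n)) ⊗[A] N))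
    (m : ℕ) : Function.Injective ((LinearMap.ker (mulPowQuot ξ f m)).subtype.lTensor N) := by
  have hle : Ideal.span {ξ} ≤ Ideal.span {ξ, f ^ (c + 1)} :=
    Ideal.span_mono (by simp)
  let p : (A ⧸ Ideal.span {ξ}) →ₗ[A] (A ⧸ Ideal.span {ξ, f ^ (c + 1)}) :=
    Submodule.mapQ _ _ LinearMap.id hle
  have hinj : Function.Injective (p ∘ₗ (LinearMap.ker (mulPowQuot ξ f m)).subtype) := by
    refine (injective_iff_map_eq_zero _).2 ?_
    rintro ⟨a, ha⟩ h
    obtain ⟨a, rfl⟩ := Submodule.Quotient.mk_surjective _ a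
    have h₁ : a ∈ Ideal.span {ξ, f ^ (c + 1)} := (Submodule.Quotient.mk_eq_zero _).1 h
    have h₂ : f ^ m * a ∈ Ideal.span {ξ} := (Submodule.Quotient.mk_eq_zero _).1 ha
    obtain ⟨x, q, rfl⟩ := Ideal.mem_span_pair.1 h₁
    obtain ⟨y, hy⟩ := Ideal.mem_span_singleton'.1 h₂
    obtain ⟨r, hr⟩ := Ideal.mem_span_singleton'.1 (hc q ⟨m + (c + 1),
      Ideal.mem_span_singleton'.2 ⟨y - f ^ m * x, by linear_combination hy⟩⟩)
    refine Subtype.ext ((Submodule.Quotient.mk_eq_zero _).2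
      (Ideal.mem_span_singleton'.2 ⟨x + f * r, ?_⟩))
    linear_combination f * hr
  have := hflat (c + 1) (by omega)
  have h := lTensor_injective_of_flat_quotient (N := N) (Ideal.span {ξ, f} ^ (c + 1)) _ hinj
    fun b hb y => by
      obtain ⟨y, rfl⟩ := Submodule.Quotient.mk_surjective _ y
      rw [← Submodule.Quotient.mk_smul, Submodule.Quotient.mk_eq_zero]
      exact Ideal.mul_mem_right _ _ (span_pair_pow_le _ hb)
  rw [LinearMap.lTensor_comp, LinearMap.coe_comp] at h
  exact h.of_comp

lemma lTensor_subtype_range_mulPowQuot_injective {m : ℕ}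
    (h : ∀ x : N, (∃ w : N, f ^ m • x = ξ • w) →
      x ∈ Submodule.comap (LinearMap.lsmul A A (f ^ m)) (Ideal.span {ξ}) •
        (⊤ : Submodule A N)) :
    Function.Injective ((LinearMap.range (mulPowQuot ξ f m)).subtype.lTensor N) := by
  refine (injective_iff_map_eq_zero _).2 fun t ht => ?_
  obtain ⟨t, rfl⟩ := LinearMap.lTensor_surjective N
    (LinearMap.surjective_rangeRestrict (mulPowQuot ξ f m)) t
  obtain ⟨x, rfl⟩ : ∃ x : N, x ⊗ₜ[A] (1 : A ⧸ Ideal.span {ξ}) = t := by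
    obtain ⟨x, hx⟩ := Submodule.Quotient.mk_surjective _
      (TensorProduct.tensorQuotEquivQuotSMul N (Ideal.span {ξ}) t)
    refine ⟨x, (TensorProduct.tensorQuotEquivQuotSMul N (Ideal.span {ξ})).injective ?_⟩
    rw [← hx]
    have := TensorProduct.tensorQuotEquivQuotSMul_tmul_mk (Ideal.span {ξ}) x 1
    rwa [one_smul] at this
  rw [LinearMap.lTensor_tmul, LinearMap.lTensor_tmul] at ht
  have hx : f ^ m • x ∈ Ideal.span {ξ} • (⊤ : Submodule A N) := by
    rw [mem_ideal_smul_top_iff_tmul_one, TensorProduct.smul_tmul]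
    exact ht
  have hK := h x (mem_span_singleton_smul_top.1 hx)
  rw [LinearMap.lTensor_tmul]
  clear ht hx
  induction hK using Submodule.smul_induction_on' with
  | smul b hb y hy =>
    rw [TensorProduct.smul_tmul, ← map_smul]
    have : (mulPowQuot ξ f m).rangeRestrict (b • (1 : A ⧸ Ideal.span {ξ})) = 0 := by
      apply Subtype.ext
      have h0 : (Submodule.Quotient.mk (f ^ m * b) : A ⧸ Ideal.span {ξ}) = 0 :=
        (Submodule.Quotient.mk_eq_zero _).2 hb
      refine Eq.trans ?_ h0
      change f ^ m • b • (Submodule.Quotient.mk (1 : A) : A ⧸ Ideal.span {ξ}) = _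
      rw [← Submodule.Quotient.mk_smul, ← Submodule.Quotient.mk_smul, smul_eq_mul, smul_eq_mul,
        mul_one]
    rw [this, TensorProduct.tmul_zero]
  | add y hy z hz h₁ h₂ => rw [TensorProduct.add_tmul, h₁, h₂, add_zero]

lemma lTensor_injective_of_smul_eq_zero
    (hflat : ∀ n : ℕ, 1 ≤ n →
      Module.Flat (A ⧸ (Ideal.span {ξ, f} ^ n)) ((A ⧸ (Ideal.span {ξ, f} ^ n)) ⊗[A] N))
    (m : ℕ) {M' M : Type u} [AddCommGroup M'] [Module A M'] [AddCommGroup M] [Module A M]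
    (i : M' →ₗ[A] M) (hi : Function.Injective i) (hξM : ∀ x : M, ξ • x = 0)
    (hfM : ∀ x : M, f ^ m • x = 0) : Function.Injective (i.lTensor N) := by
  have := hflat (m + 1) (by omega)
  refine lTensor_injective_of_flat_quotient (Ideal.span {ξ, f} ^ (m + 1)) i hi fun a ha x => ?_
  obtain ⟨p, q, rfl⟩ := Ideal.mem_span_pair.1 (span_pair_pow_le _ ha)
  rw [add_smul, mul_smul, mul_smul, hξM, pow_succ', mul_smul, hfM]
  simp

theorem torVanish_quotient_span_pair (hξ : ξ ∈ nonZeroDivisors A)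
    (hc : ∀ a : A, (∃ n : ℕ, f ^ n * a ∈ Ideal.span {ξ}) → f ^ c * a ∈ Ideal.span {ξ})
    (hflat : ∀ n : ℕ, 1 ≤ n →
      Module.Flat (A ⧸ (Ideal.span {ξ, f} ^ n)) ((A ⧸ (Ideal.span {ξ, f} ^ n)) ⊗[A] N))
    [IsAdicComplete (Ideal.span {ξ, f}) N] : TorVanish A N (A ⧸ Ideal.span {ξ, f}) := by
  intro i hi
  obtain ⟨n, rfl⟩ : ∃ n, i = n + 1 := ⟨i - 1, by omega⟩
  refine SyzygyTorVanish.subsingleton_tor n N (SyzygyTorVanish.of_smul_eq_zero (ξ := ξ) (f := f)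
    (fun n => .quot_span_singleton hξ (fun x => eq_zero_of_smul_eq_zero hξ hc hflat) n)
    (lTensor_subtype_ker_mulPowQuot_injective hc hflat)
    (fun m => lTensor_subtype_range_mulPowQuot_injective
      fun x => mem_smul_top_of_pow_smul_eq hξ hc hflat)
    (fun m _ _ _ _ _ _ i hi => lTensor_injective_of_smul_eq_zero hflat m i hi) n 1 _ ?_ ?_)
  · intro x
    obtain ⟨x, rfl⟩ := Submodule.Quotient.mk_surjective _ x
    rw [← Submodule.Quotient.mk_smul, Submodule.Quotient.mk_eq_zero]
    exact Ideal.mul_mem_right _ _ (Ideal.subset_span (by simp))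
  · intro x
    obtain ⟨x, rfl⟩ := Submodule.Quotient.mk_surjective _ x
    rw [← Submodule.Quotient.mk_smul, Submodule.Quotient.mk_eq_zero]
    exact Ideal.mul_mem_right _ _ (Ideal.subset_span (by simp))

end Completeness

section DerivedCompleteness

variable {A : Type u} [CommRing A] {N : Type u} [AddCommGroup N] [Module A N]

lemma exists_sub_smul_eq (J : Ideal A) [IsAdicComplete J N] {g : A} (hg : g ∈ J) (b : ℕ → N) :
    ∃ a : ℕ → N, ∀ n, a n - g • a (n + 1) = b n := by
  have hpow (k : ℕ) (x : N) : g ^ k • x ∈ J ^ k • (⊤ : Submodule A N) :=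
    Submodule.smul_mem_smul (Ideal.pow_mem_pow hg k) trivial
  have hex (n : ℕ) : ∃ a : N, ∀ k : ℕ,
      a - ∑ j ∈ Finset.range k, g ^ j • b (n + j) ∈ J ^ k • (⊤ : Submodule A N) := by
    obtain ⟨a, ha⟩ := IsPrecomplete.prec (I := J) (M := N) inferInstance
      (f := fun k => ∑ j ∈ Finset.range k, g ^ j • b (n + j)) fun {m k} hmk => by
        rw [SModEq.comm, SModEq.sub_mem, ← Finset.sum_sdiff (Finset.range_subset_range.2 hmk),
          add_sub_cancel_right]
        refine Submodule.sum_mem _ fun j hj => ?_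
        have hj' : m ≤ j := by simpa using (Finset.mem_sdiff.1 hj).2
        exact Submodule.smul_mono_left (Ideal.pow_le_pow_right hj') (hpow j _)
    exact ⟨a, fun k => by rw [← SModEq.sub_mem, SModEq.comm]; exact ha k⟩
  choose a ha using hex
  refine ⟨a, fun n => sub_eq_zero.1 (IsHausdorff.haus (I := J) inferInstance _ fun k => ?_)⟩
  rw [SModEq.zero]
  have h₁ := Submodule.smul_mono_left (Ideal.pow_le_pow_right (Nat.le_succ k)) (ha n (k + 1))
  have h₂ := Submodule.smul_mem _ g (ha (n + 1) k)
  convert sub_mem h₁ h₂ using 1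
  rw [Finset.sum_range_succ', smul_sub, Finset.smul_sum]
  simp only [smul_smul, pow_zero, one_smul, add_zero, pow_succ', add_assoc, add_comm 1]
  abel

lemma localizationAway_linearMap_eq_zero (J : Ideal A) [IsHausdorff J N] {g : A} (hg : g ∈ J)
    (h : Localization.Away g →ₗ[A] N) : h = 0 := by
  ext x
  refine IsHausdorff.haus (I := J) inferInstance _ fun k => ?_
  rw [SModEq.zero]
  have hx : g ^ k • (Localization.mk 1 (⟨g ^ k, k, rfl⟩ : Submonoid.powers g) * x) = x := by
    rw [Algebra.smul_def, ← mul_assoc, ← Algebra.smul_def, Localization.smul_mk]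
    have : Localization.mk (g ^ k • (1 : A)) (⟨g ^ k, k, rfl⟩ : Submonoid.powers g) = 1 := by
      rw [smul_eq_mul, mul_one]
      exact Localization.mk_self (⟨g ^ k, k, rfl⟩ : Submonoid.powers g)
    rw [this, one_mul]
  rw [← hx, map_smul]
  exact Submodule.smul_mem_smul (Ideal.pow_mem_pow hg k) trivial

/-- The generators `g⁻ⁿ` of `A_g`. -/
noncomputable def invPow (g : A) (n : ℕ) : Localization.Away g :=
  Localization.mk 1 (⟨g ^ n, n, rfl⟩ : Submonoid.powers g)

lemma smul_invPow_succ (g : A) (n : ℕ) : g • invPow g (n + 1) = invPow g n := by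
  rw [invPow, invPow, Localization.smul_mk, Localization.mk_eq_mk_iff, Localization.r_iff_exists]
  exact ⟨1, by simp [pow_succ']; ring⟩

lemma pow_smul_invPow_add (g : A) (n m : ℕ) : g ^ m • invPow g (n + m) = invPow g n := by
  induction m with
  | zero => simp
  | succ m ih => rw [pow_succ, mul_smul, ← add_assoc, smul_invPow_succ, ih]

lemma linearCombination_invPow_surjective (g : A) :
    Function.Surjective (Finsupp.linearCombination A (invPow g)) := by
  intro x
  induction x using Localization.induction_on with
  | H y =>
    obtain ⟨a, s, n, rfl⟩ := y
    refine ⟨Finsupp.single n a, ?_⟩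
    rw [Finsupp.linearCombination_single, invPow, Localization.smul_mk, smul_eq_mul, mul_one]

lemma linearMap_eq_zero_of_linearCombination_invPow_eq_zero {g : A}
    (T : (ℕ →₀ A) →ₗ[A] N)
    (hT : ∀ n, T (Finsupp.single n 1) = g • T (Finsupp.single (n + 1) 1))
    {v : ℕ →₀ A} (hv : Finsupp.linearCombination A (invPow g) v = 0) : T v = 0 := by
  have hT' (n m : ℕ) : T (Finsupp.single n 1) = g ^ m • T (Finsupp.single (n + m) 1) := by
    induction m with
    | zero => simp
    | succ m ih => rw [ih, hT, pow_succ, mul_smul, add_assoc]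
  obtain ⟨L, hL⟩ : ∃ L, ∀ n ∈ v.support, n ≤ L :=
    ⟨v.support.sup id, fun n hn => Finset.le_sup (f := id) hn⟩
  have hTv : T v = (∑ n ∈ v.support, v n * g ^ (L - n)) • T (Finsupp.single L 1) := by
    conv_lhs => rw [← Finsupp.sum_single v]
    rw [Finsupp.sum, map_sum, Finset.sum_smul]
    refine Finset.sum_congr rfl fun n hn => ?_
    rw [mul_smul]
    conv_rhs => rw [show L = n + (L - n) by have := hL n hn; omega, Nat.add_sub_cancel_left]
    rw [← hT', ← map_smul, Finsupp.smul_single, smul_eq_mul, mul_one]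
  have hsv : (∑ n ∈ v.support, v n * g ^ (L - n)) • invPow g L = 0 := by
    rw [← hv, Finsupp.linearCombination_apply, Finsupp.sum, Finset.sum_smul]
    refine Finset.sum_congr rfl fun n hn => ?_
    rw [mul_smul]
    conv_lhs => rw [show L = n + (L - n) by have := hL n hn; omega, Nat.add_sub_cancel_left]
    rw [pow_smul_invPow_add]
  set a := ∑ n ∈ v.support, v n * g ^ (L - n)
  obtain ⟨M, hM⟩ : ∃ M, g ^ M * a = 0 := by
    rw [invPow, Localization.smul_mk, smul_eq_mul, mul_one, Localization.mk_eq_mk',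
      IsLocalization.mk'_eq_zero_iff] at hsv
    obtain ⟨⟨_, M, rfl⟩, h⟩ := hsv
    exact ⟨M, h⟩
  rw [hTv, hT' L M, smul_smul, mul_comm, hM, zero_smul]

variable {Q₂ Q₁ Q₀ : Type u} [AddCommGroup Q₂] [Module A Q₂] [AddCommGroup Q₁] [Module A Q₁]
  [AddCommGroup Q₀] [Module A Q₀]

/-- A cocycle on a projective presentation of `A_g` with values in `N` is a coboundary as soon as
the equations `aₙ - g aₙ₊₁ = bₙ` are solvable in `N`. -/
lemma exists_comp_eq_of_projective_presentation {g : A}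
    (hN : ∀ b : ℕ → N, ∃ a : ℕ → N, ∀ n, a n - g • a (n + 1) = b n)
    [Module.Projective A Q₀] (d₂ : Q₂ →ₗ[A] Q₁) (d₁ : Q₁ →ₗ[A] Q₀)
    (π : Q₀ →ₗ[A] Localization.Away g) (hπ : Function.Surjective π)
    (h₁ : Function.Exact d₁ π) (h₂ : Function.Exact d₂ d₁)
    (φ : Q₁ →ₗ[A] N) (hφ : φ ∘ₗ d₂ = 0) : ∃ ψ : Q₀ →ₗ[A] N, ψ ∘ₗ d₁ = φ := by
  have hφ' (x : Q₁) (hx : d₁ x = 0) : φ x = 0 := by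
    obtain ⟨y, rfl⟩ := (h₂ x).1 hx
    exact LinearMap.congr_fun hφ y
  choose q hq using fun n => hπ (invPow g n)
  have hr (n : ℕ) : ∃ r, d₁ r = q n - g • q (n + 1) :=
    (h₁ _).1 (by rw [map_sub, map_smul, hq, hq, smul_invPow_succ, sub_self])
  choose r hr using hr
  obtain ⟨a, ha⟩ := hN fun n => φ (r n)
  let s := Finsupp.linearCombination A (invPow g)
  let β := Finsupp.linearCombination A q
  have hβ : π ∘ₗ β = s := by
    ext n
    simp [β, s, hq]
  obtain ⟨α, hα⟩ := Module.projective_lifting_property s π (linearCombination_invPow_surjective g)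
  have hγ : ∀ x : Q₀, (LinearMap.id - β ∘ₗ α : Q₀ →ₗ[A] Q₀) x ∈ LinearMap.range d₁ := fun x => by
    refine (h₁ _).1 ?_
    have e₁ := LinearMap.congr_fun hβ (α x)
    have e₂ := LinearMap.congr_fun hα x
    simp only [LinearMap.comp_apply] at e₁ e₂
    simp [e₁, e₂]
  obtain ⟨γ, hγ'⟩ := Module.projective_lifting_property d₁.rangeRestrict
    ((LinearMap.id - β ∘ₗ α : Q₀ →ₗ[A] Q₀).codRestrict (LinearMap.range d₁) hγ) d₁.surjective_rangeRestrict
  have hdγ (x : Q₀) : d₁ (γ x) = x - β (α x) :=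
    congrArg Subtype.val (LinearMap.congr_fun hγ' x)
  let l := Finsupp.linearCombination A a
  refine ⟨φ ∘ₗ γ + l ∘ₗ α, LinearMap.ext fun x => ?_⟩
  let I := LinearMap.range (d₁.prod φ)
  have hv : I.mkQ.comp (β.prod l) (α (d₁ x)) = 0 := by
    refine linearMap_eq_zero_of_linearCombination_invPow_eq_zero _ (fun n => ?_) (g := g) ?_
    · rw [← sub_eq_zero, ← map_smul, ← map_sub, LinearMap.comp_apply, Submodule.mkQ_apply,
        Submodule.Quotient.mk_eq_zero]
      refine ⟨r n, ?_⟩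
      simp [β, l, hr, ha]
    · exact (LinearMap.congr_fun hα (d₁ x)).trans (h₁.apply_apply_eq_zero x)
  obtain ⟨y, hy⟩ := (Submodule.Quotient.mk_eq_zero I).1 hv
  have hy₁ : d₁ y = β (α (d₁ x)) := congrArg Prod.fst hy
  have hy₂ : φ y = l (α (d₁ x)) := congrArg Prod.snd hy
  have h := hφ' (γ (d₁ x) + y - x) (by rw [map_sub, map_add, hdγ, hy₁]; abel)
  rw [map_sub, map_add, hy₂, sub_eq_zero] at h
  exact h

theorem derivedComplete_of_isAdicComplete (J : Ideal A) [IsAdicComplete J N] {g : A}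
    (hg : g ∈ J) : DerivedComplete A g N := by
  refine ⟨localizationAway_linearMap_eq_zero J hg, ?_⟩
  let P := projectiveResolution (ModuleCat.of A (Localization.Away g))
  have : Module.Projective A (P.complex.X 0) :=
    (IsProjective.iff_projective _).2 (P.projective 0)
  have hπ : Function.Surjective (P.π.f 0).hom := (ModuleCat.epi_iff_surjective _).1 inferInstance
  have h₁ := (ModuleCat.exact_iff_function_exact _).1 P.exact₀
  have h₂ := (ModuleCat.exact_iff_function_exact _).1 (P.exact_succ 0)
  refine ModuleCat.subsingleton_of_isZero
    (Limits.IsZero.of_iso ?_ (P.isoExt 1 (ModuleCat.of A N)))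
  rw [← HomologicalComplex.exactAt_iff_isZero_homology,
    HomologicalComplex.exactAt_iff' _ 0 1 2 (by simp) (by simp),
    ModuleCat.exact_iff_function_exact]
  intro φ
  constructor
  · intro hφ
    have hφ' : P.complex.d 2 1 ≫ (show P.complex.X 1 ⟶ ModuleCat.of A N from φ) = 0 := hφ
    obtain ⟨ψ, hψ⟩ := exists_comp_eq_of_projective_presentation
      (exists_sub_smul_eq J hg) _ _ (P.π.f 0).hom hπ h₁ h₂
      (ModuleCat.Hom.hom (show P.complex.X 1 ⟶ ModuleCat.of A N from φ))
      (by rw [← ModuleCat.hom_comp]; exact congrArg ModuleCat.Hom.hom hφ')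
    exact ⟨(show P.complex.X 0 ⟶ ModuleCat.of A N from ModuleCat.ofHom ψ), ModuleCat.hom_ext hψ⟩
  · rintro ⟨ψ, rfl⟩
    change P.complex.d 2 1 ≫ P.complex.d 1 0 ≫ (show P.complex.X 0 ⟶ ModuleCat.of A N from ψ) = 0
    rw [← Category.assoc, P.complex.d_comp_d, Limits.zero_comp]

end DerivedCompleteness

/-- Let `ξ, f ∈ A` be nonzerodivisors with `A` derived `ξ`-complete and
derived `f`-complete, `A/ξA` of bounded `f^∞`-torsion, `J = (ξ, f)`, and `N` a `J`-adically
complete `A`-module with `N/J^nN` flat over `A/J^n` for all `n ≥ 1`. Then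
`Tor_i^A(N, A/J) = 0` for all `i ≥ 1`, `N` is derived `J`-complete (derived `ξ`-complete and
derived `f`-complete), and if each `N/J^nN` is faithfully flat over `A/J^n` then `N/JN` is
faithfully flat over `A/J`. -/
theorem prismaticType_complete_flat (A : Type u) [CommRing A] (ξ f : A)
    (hξ : ξ ∈ nonZeroDivisors A) (hf : f ∈ nonZeroDivisors A)
    (hderξ : DerivedComplete A ξ A) (hderf : DerivedComplete A f A)
    (hbdd : ∃ c : ℕ, ∀ a : A, (∃ n : ℕ, f ^ n * a ∈ Ideal.span {ξ}) → f ^ c * a ∈ Ideal.span {ξ})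
    (N : Type u) [AddCommGroup N] [Module A N]
    (hcomplete : IsAdicComplete (Ideal.span {ξ, f}) N)
    (hflat : ∀ n : ℕ, 1 ≤ n →
      Module.Flat (A ⧸ (Ideal.span {ξ, f} ^ n)) ((A ⧸ (Ideal.span {ξ, f} ^ n)) ⊗[A] N)) :
    (TorVanish A N (A ⧸ Ideal.span {ξ, f}) ∧
      (DerivedComplete A ξ N ∧ DerivedComplete A f N)) ∧
    ((∀ n : ℕ, 1 ≤ n →
        Module.FaithfullyFlat (A ⧸ (Ideal.span {ξ, f} ^ n))
          ((A ⧸ (Ideal.span {ξ, f} ^ n)) ⊗[A] N)) →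
      Module.FaithfullyFlat (A ⧸ Ideal.span {ξ, f}) ((A ⧸ Ideal.span {ξ, f}) ⊗[A] N)) := by
  obtain ⟨c, hc⟩ := hbdd
  refine ⟨⟨torVanish_quotient_span_pair hξ hc hflat,
    derivedComplete_of_isAdicComplete (Ideal.span {ξ, f}) (Ideal.subset_span (by simp)),
    derivedComplete_of_isAdicComplete (Ideal.span {ξ, f}) (Ideal.subset_span (by simp))⟩,
    fun h => ?_⟩
  have h₁ := h 1 le_rfl
  rwa [pow_one] at h₁
end
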